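/- Let p, q and p′, q′ be two pairs of relatively prime positive integers, and let x be either S(0,q/p) or S′(0,q/p) and y be either S(0,q′/p′) or S′(0,q′/p′). Then the subshift generated by x and the subshift generated by y are flow equivalent. -/

import Mathlib

open Classical

/-- The shift map `σ` on bi-infinite sequences: `σ(x)_i = x_{i+1}`. -/
def shiftMap {A : Type*} (x : ℤ → A) : ℤ → A := fun i => x (i + 1)

/-- The iterated shift `σ^k` for `k ∈ ℤ`: `σ^k(x)_i = x_{i+k}`. -/
def shiftZ {A : Type*} (k : ℤ) (x : ℤ → A) : ℤ → A := fun i => x (i + k)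

/-- `x` is periodic with period `N > 0`, i.e. `σ^N(x) = x`. -/
def IsPeriodicWith {A : Type*} (x : ℤ → A) (N : ℕ) : Prop :=
  0 < N ∧ ∀ i : ℤ, x (i + N) = x i

/-- `x` is periodic (with some period `N > 0`). -/
def IsPeriodicSeq {A : Type*} (x : ℤ → A) : Prop := ∃ N : ℕ, IsPeriodicWith x N

/-- The sequence `p(x;i,n)` obtained from `x` by removing the block `x_{i+1} ⋯ x_{i+n}`. -/
def removeBlock {A : Type*} (x : ℤ → A) (i : ℤ) (n : ℕ) : ℤ → A :=
  fun k => if k ≤ i then x k else x (k + n)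

/-- `(i,n)` is an anomaly occurrence of `x`: `n > 0` and `p(x;i,n)` is periodic. -/
def IsAnomalyOcc {A : Type*} (x : ℤ → A) (i : ℤ) (n : ℕ) : Prop :=
  0 < n ∧ IsPeriodicSeq (removeBlock x i n)

/-- `x` is eventually periodic: non-periodic, but removing some block leaves a periodic sequence. -/
def EventuallyPeriodic {A : Type*} (x : ℤ → A) : Prop :=
  ¬ IsPeriodicSeq x ∧ ∃ (i : ℤ) (n : ℕ), IsAnomalyOcc x i n

/-- The least period of an eventually periodic sequence `x`: the least period of
`p(x;i,n)` over anomaly occurrences `(i,n)` of `x`. -/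
noncomputable def evLeastPeriod {A : Type*} (x : ℤ → A) : ℕ :=
  sInf {N : ℕ | ∃ (i : ℤ) (n : ℕ), IsAnomalyOcc x i n ∧ IsPeriodicWith (removeBlock x i n) N}

/-- The anomaly size `a(x)`: the minimum of `n` over anomaly occurrences `(i,n)` of `x`. -/
noncomputable def anomalySize {A : Type*} (x : ℤ → A) : ℕ :=
  sInf {n : ℕ | ∃ i : ℤ, IsAnomalyOcc x i n}

/-- The orbit `{σ^k(x) : k ∈ ℤ}` of a bi-infinite sequence. -/
def seqOrbit {A : Type*} (x : ℤ → A) : Set (ℤ → A) := {y | ∃ k : ℤ, y = shiftZ k x}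

/-- The subshift generated by `x`: the closure of its orbit in the product topology. -/
def subshiftGen {A : Type*} [TopologicalSpace A] (x : ℤ → A) : Set (ℤ → A) :=
  closure (seqOrbit x)

/-- Two subshifts are conjugate if there is a homeomorphism between them commuting
with the shift. -/
def Conjugate {A B : Type*} [TopologicalSpace A] [TopologicalSpace B]
    (X : Set (ℤ → A)) (Y : Set (ℤ → B)) : Prop :=
  ∃ φ : X ≃ₜ Y, ∀ (u : ℤ → A) (hu : u ∈ X) (hu' : shiftMap u ∈ X),
    ((φ ⟨shiftMap u, hu'⟩ : Y) : ℤ → B) = shiftMap ((φ ⟨u, hu⟩ : Y) : ℤ → B)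

/-- The relation generating the suspension: `(x,s) ∼ (σ^n(x), s - n)`. -/
def SuspRel {A : Type*} (X : Set (ℤ → A)) : (X × ℝ) → (X × ℝ) → Prop :=
  fun p q => ∃ n : ℤ, (q.1 : ℤ → A) = shiftZ n (p.1 : ℤ → A) ∧ q.2 = p.2 - n

/-- The suspension `ΣX` of a subshift `X`. -/
def Susp {A : Type*} [TopologicalSpace A] (X : Set (ℤ → A)) : Type _ :=
  Quot (SuspRel X)

instance {A : Type*} [TopologicalSpace A] (X : Set (ℤ → A)) : TopologicalSpace (Susp X) :=
  instTopologicalSpaceQuot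

/-- The suspension flow `φ_t [x,s] = [x, s+t]`. -/
def suspFlow {A : Type*} [TopologicalSpace A] (X : Set (ℤ → A)) (t : ℝ) :
    Susp X → Susp X :=
  Quot.lift (fun p => Quot.mk _ (p.1, p.2 + t)) (by
    rintro p r ⟨n, h1, h2⟩
    exact Quot.sound ⟨n, h1, by rw [h2]; ring⟩)

/-- Two subshifts are flow equivalent if there is a homeomorphism of their suspensions
taking flow lines to flow lines in an orientation-preserving way. -/
def FlowEquiv {A B : Type*} [TopologicalSpace A] [TopologicalSpace B]
    (X : Set (ℤ → A)) (Y : Set (ℤ → B)) : Prop :=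
  ∃ h : Susp X ≃ₜ Susp Y, ∀ u : Susp X, ∃ τ : ℝ → ℝ,
    StrictMono τ ∧ Function.Bijective τ ∧ τ 0 = 0 ∧
      ∀ t : ℝ, h (suspFlow X t u) = suspFlow Y (τ t) (h u)

/-- Cell lengths `z_n` for the type-`S` skew Sturmian sequence `S(0, q/p)`, with `β = p/q`. -/
noncomputable def cellLenS (p q : ℤ) (n : ℤ) : ℕ :=
  if n < 0 then
    ({k : ℤ | (n : ℚ) < (k : ℚ) * ((p : ℚ) / (q : ℚ)) ∧
        (k : ℚ) * ((p : ℚ) / (q : ℚ)) ≤ (n : ℚ) + 1}).ncard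
  else if n = 0 then
    ({k : ℤ | 0 < (k : ℚ) * ((p : ℚ) / (q : ℚ)) ∧
        (k : ℚ) * ((p : ℚ) / (q : ℚ)) < 1}).ncard
  else
    ({k : ℤ | (n : ℚ) ≤ (k : ℚ) * ((p : ℚ) / (q : ℚ)) ∧
        (k : ℚ) * ((p : ℚ) / (q : ℚ)) < (n : ℚ) + 1}).ncard

/-- Cell lengths `z′_n` for the type-`S′` skew Sturmian sequence `S′(0, q/p)`, with `β = p/q`. -/
noncomputable def cellLenS' (p q : ℤ) (n : ℤ) : ℕ :=
  if n < 0 then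
    ({k : ℤ | (n : ℚ) ≤ (k : ℚ) * ((p : ℚ) / (q : ℚ)) ∧
        (k : ℚ) * ((p : ℚ) / (q : ℚ)) < (n : ℚ) + 1}).ncard
  else if n = 0 then
    ({k : ℤ | 0 ≤ (k : ℚ) * ((p : ℚ) / (q : ℚ)) ∧
        (k : ℚ) * ((p : ℚ) / (q : ℚ)) ≤ 1}).ncard
  else
    ({k : ℤ | (n : ℚ) < (k : ℚ) * ((p : ℚ) / (q : ℚ)) ∧
        (k : ℚ) * ((p : ℚ) / (q : ℚ)) ≤ (n : ℚ) + 1}).ncard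

/-- The position `L_n` of the leading `1` of the cell `B_n`. -/
noncomputable def cellStart (z : ℤ → ℕ) (n : ℤ) : ℤ :=
  if 0 ≤ n then n + ∑ j ∈ Finset.Ico (0 : ℤ) n, (z j : ℤ)
  else n - ∑ j ∈ Finset.Ico n (0 : ℤ), (z j : ℤ)

/-- The `{0,1}`-sequence determined by cell lengths `z`: a `1` at each position `L_n`
and `0` elsewhere. -/
noncomputable def seqOfCells (z : ℤ → ℕ) : ℤ → Fin 2 :=
  fun i => if ∃ n : ℤ, i = cellStart z n then 1 else 0

/-- The type-`S` skew Sturmian sequence `S(0, q/p)`. -/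
noncomputable def sturmS (p q : ℤ) : ℤ → Fin 2 := seqOfCells (cellLenS p q)

/-- The type-`S′` skew Sturmian sequence `S′(0, q/p)`. -/
noncomputable def sturmS' (p q : ℤ) : ℤ → Fin 2 := seqOfCells (cellLenS' p q)


open Topology Filter

/-- `x` is homoclinic to the periodic sequence `w` of least period `N`: it follows `w` up to
position `a`, and follows `w` advanced by `d` from position `a + d` on. -/
structure IsHomoclinic {A : Type*} (x w : ℤ → A) (N a d : ℤ) : Prop where
  pos : 0 < N
  shift_eq_iff : ∀ k, shiftZ k w = w ↔ N ∣ k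
  nonneg : 0 ≤ d
  left : ∀ i ≤ a, x i = w i
  right : ∀ i, a + d ≤ i → x i = w (i + d)
  ne : x ≠ w

theorem shiftZ_shiftZ {A : Type*} (m n : ℤ) (x : ℤ → A) :
    shiftZ m (shiftZ n x) = shiftZ (n + m) x := by
  funext i
  simp only [shiftZ]
  congr 1
  ring

theorem shiftZ_zero {A : Type*} (x : ℤ → A) : shiftZ 0 x = x := by
  funext i
  simp [shiftZ]

theorem shiftZ_injective {A : Type*} (m : ℤ) :
    Function.Injective (shiftZ m : (ℤ → A) → ℤ → A) := by
  intro x y h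
  have := congrArg (shiftZ (-m)) h
  simpa [shiftZ_shiftZ, shiftZ_zero] using this

/-- A reparametrization of the line that is the identity far to the left and the translation
by `d` far to the right. -/
noncomputable def winding (a d : ℤ) (t : ℝ) : ℝ := t + max 0 (min (d : ℝ) (t - a))

theorem winding_strictMono (a d : ℤ) : StrictMono (winding a d) := by
  apply StrictMono.add_monotone strictMono_id
  intro s t h
  exact max_le_max le_rfl (min_le_min le_rfl (by linarith))

theorem winding_continuous (a d : ℤ) : Continuous (winding a d) := by
  unfold winding
  fun_prop

theorem le_winding (a d : ℤ) (t : ℝ) : t ≤ winding a d t :=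
  le_add_of_nonneg_right (le_max_left _ _)

theorem winding_le {a d : ℤ} (hd : 0 ≤ d) (t : ℝ) : winding a d t ≤ t + d := by
  have : (0 : ℝ) ≤ d := by exact_mod_cast hd
  exact add_le_add_right (max_le this (min_le_left _ _)) _

theorem winding_of_le {a d : ℤ} {t : ℝ} (h : t ≤ a) : winding a d t = t := by
  unfold winding
  rw [max_eq_left, add_zero]
  exact (min_le_right _ _).trans (by linarith)

theorem winding_of_ge {a d : ℤ} (hd : 0 ≤ d) {t : ℝ} (h : a + d ≤ t) :
    winding a d t = t + d := by
  have : (0 : ℝ) ≤ d := by exact_mod_cast hd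
  unfold winding
  rw [min_eq_left (by linarith), max_eq_right this]

theorem winding_surjective {a d : ℤ} (hd : 0 ≤ d) : Function.Surjective (winding a d) := by
  apply (winding_continuous a d).surjective
  · exact tendsto_atTop_mono (le_winding a d) tendsto_id
  · exact tendsto_atBot_mono (winding_le hd) (tendsto_atBot_add_const_right _ _ tendsto_id)

/-- A line spiralling in both directions towards the circle `limitCircle`. -/
noncomputable def spiral (r : ℝ) : UnitAddCircle × OnePoint ℝ :=
  ((r : UnitAddCircle), (r : OnePoint ℝ))

/-- The circle at infinity of the spiral. -/
noncomputable def limitCircle (r : ℝ) : UnitAddCircle × OnePoint ℝ :=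
  ((r : UnitAddCircle), OnePoint.infty)

/-- The flow moving along the spiral and its limit circle at unit speed. -/
noncomputable def spiralFlow (t : ℝ) (p : UnitAddCircle × OnePoint ℝ) :
    UnitAddCircle × OnePoint ℝ :=
  (p.1 + (t : UnitAddCircle), OnePoint.map (· + t) p.2)

theorem spiralFlow_spiral (t r : ℝ) : spiralFlow t (spiral r) = spiral (r + t) := by
  simp [spiralFlow, spiral]

theorem spiralFlow_limitCircle (t r : ℝ) :
    spiralFlow t (limitCircle r) = limitCircle (r + t) := by
  simp [spiralFlow, limitCircle]

theorem limitCircle_eq_iff {r s : ℝ} : limitCircle r = limitCircle s ↔ ∃ m : ℤ, s = r + m := by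
  simp only [limitCircle, Prod.mk.injEq, and_true]
  rw [eq_comm, ← sub_eq_zero, ← AddCircle.coe_sub, AddCircle.coe_eq_zero_iff]
  constructor
  · rintro ⟨n, hn⟩
    exact ⟨n, by simp at hn; linarith⟩
  · rintro ⟨n, hn⟩
    exact ⟨n, by simp; linarith⟩

theorem spiral_injective : Function.Injective spiral := by
  intro r s h
  simpa [spiral] using congrArg Prod.snd h

theorem spiral_ne_limitCircle (r s : ℝ) : spiral r ≠ limitCircle s := by
  intro h
  simpa [spiral, limitCircle] using congrArg Prod.snd h

theorem continuous_spiral : Continuous spiral :=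
  (AddCircle.continuous_mk' 1).prodMk OnePoint.continuous_coe

namespace IsHomoclinic

variable {A : Type*} {x w : ℤ → A} {N a d : ℤ}

theorem shiftZ_eq_shiftZ_iff (h : IsHomoclinic x w N a d) {j k : ℤ} :
    shiftZ j w = shiftZ k w ↔ N ∣ j - k := by
  rw [← h.shift_eq_iff, ← (shiftZ_injective k).eq_iff (a := shiftZ (j - k) w), shiftZ_shiftZ,
    sub_add_cancel]

theorem apply_add_mul (h : IsHomoclinic x w N a d) (i m : ℤ) : w (i + N * m) = w i :=
  congrFun ((h.shift_eq_iff (N * m)).2 (dvd_mul_right _ _)) i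

theorem dvd_of_window (h : IsHomoclinic x w N a d) {j k : ℤ}
    (hw : ∀ i, 0 ≤ i → i < N → w (i + j) = w (i + k)) : N ∣ j - k := by
  rw [← h.shiftZ_eq_shiftZ_iff]
  funext i
  have e := Int.emod_add_mul_ediv i N
  have := hw (i % N) (Int.emod_nonneg _ h.pos.ne') (Int.emod_lt_of_pos _ h.pos)
  rw [← h.apply_add_mul _ (i / N), ← h.apply_add_mul (_ + k) (i / N)] at this
  simp only [shiftZ]
  convert this using 2 <;> linarith

/-- A sequence invariant under a nonzero shift and agreeing with `w` far to the left is `w`. -/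
theorem eq_of_eventually (h : IsHomoclinic x w N a d) {u : ℤ → A} {m b : ℤ} (hm : 0 < m)
    (hu : shiftZ m u = u) (hb : ∀ i ≤ b, u i = w i) : u = w := by
  have hu' (i : ℤ) (n : ℕ) : u (i - n * m) = u i := by
    induction n with
    | zero => simp
    | succ n ih =>
      rw [← ih, ← congrFun hu (i - _)]
      simp only [shiftZ]
      congr 1
      push_cast
      ring
  funext i
  have hN := h.pos
  have e1 := hu' i (N.toNat * (i - b).toNat)
  rw [← e1, hb]
  · have := h.apply_add_mul i (-((i - b).toNat * m))
    rw [← this]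
    congr 1
    push_cast
    rw [Int.toNat_of_nonneg hN.le]
    ring
  · push_cast
    rw [Int.toNat_of_nonneg hN.le]
    have h1 : i - b ≤ (i - b).toNat := Int.self_le_toNat _
    have h2 : (0:ℤ) ≤ (i - b).toNat := by positivity
    have h3 : 1 ≤ N * m := Int.mul_pos hN hm
    nlinarith

theorem shiftZ_ne (h : IsHomoclinic x w N a d) (j k : ℤ) : shiftZ j x ≠ shiftZ k w := by
  intro e
  refine h.ne (h.eq_of_eventually h.pos ?_ h.left)
  apply shiftZ_injective j
  rw [shiftZ_shiftZ, add_comm, ← shiftZ_shiftZ, e, shiftZ_shiftZ, add_comm, ← shiftZ_shiftZ,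
    (h.shift_eq_iff N).2 dvd_rfl]

theorem shiftZ_self_injective (h : IsHomoclinic x w N a d) :
    Function.Injective fun k => shiftZ k x := by
  have key : ∀ j k, j < k → shiftZ j x ≠ shiftZ k x := by
    intro j k hjk e
    refine h.ne (h.eq_of_eventually (sub_pos.2 hjk) ?_ h.left)
    apply shiftZ_injective j
    rw [shiftZ_shiftZ, sub_add_cancel, e]
  intro j k e
  rcases lt_trichotomy j k with hlt | heq | hgt
  · exact absurd e (key j k hlt)
  · exact heq
  · exact absurd e.symm (key k j hgt)

section Topology

variable [TopologicalSpace A]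

theorem shiftZ_limit_mem (h : IsHomoclinic x w N a d) (k : ℤ) :
    shiftZ k w ∈ subshiftGen x := by
  have ht : Tendsto (fun n : ℕ => shiftZ (k - N * n) x) atTop (𝓝 (shiftZ k w)) := by
    rw [tendsto_pi_nhds]
    intro i
    apply tendsto_nhds_of_eventually_eq
    filter_upwards [eventually_ge_atTop (i + k - a).toNat] with n hn
    have hN := h.pos
    have h1 : i + k - a ≤ n := Int.toNat_le.1 hn
    have h2 : (n : ℤ) ≤ N * n := by nlinarith [Int.natCast_nonneg n]
    simp only [shiftZ]
    rw [h.left _ (by linarith), ← h.apply_add_mul _ n]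
    congr 1
    ring
  exact mem_closure_of_tendsto ht (Eventually.of_forall fun n => ⟨_, rfl⟩)

variable [DiscreteTopology A]

theorem eventually_apply_eq (y : ℤ → A) (i : ℤ) : ∀ᶠ u in 𝓝 y, u i = y i :=
  ((continuous_apply i).tendsto y).eventually (p := (· = y i)) (by simp [nhds_discrete])

theorem eventually_window_eq (y : ℤ → A) (m n : ℤ) :
    ∀ᶠ u in 𝓝 y, ∀ i, m ≤ i → i ≤ n → u i = y i := by
  have := (Set.finite_Icc m n).eventually_all (p := fun i u => u i = y i) (l := 𝓝 y)
  filter_upwards [this.2 fun i _ => eventually_apply_eq y i] with u hu i h1 h2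
  exact hu i ⟨h1, h2⟩

theorem eventually_ne_shiftZ {y : ℤ → A} (m n : ℤ)
    (hy : ∀ j, m ≤ j → j ≤ n → y ≠ shiftZ j x) :
    ∀ᶠ u in 𝓝 y, ∀ j, m ≤ j → j ≤ n → u ≠ shiftZ j x := by
  have := (Set.finite_Icc m n).eventually_all (p := fun j u => u ≠ shiftZ j x) (l := 𝓝 y)
  filter_upwards [this.2 fun i hi => isOpen_ne.mem_nhds (hy i hi.1 hi.2)] with u hu i h1 h2
  exact hu i ⟨h1, h2⟩

theorem exists_eventually_of_ne (h : IsHomoclinic x w N a d) {y : ℤ → A}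
    (hy : ∀ k, y ≠ shiftZ k w) :
    ∃ M : ℤ, ∀ᶠ u in 𝓝 y, (∀ k, u ≠ shiftZ k w) ∧ ∀ j, u = shiftZ j x → -M ≤ j ∧ j ≤ M := by
  have h1 (k : ℤ) : ∃ i, y i ≠ w (i + k) := Function.ne_iff.1 (hy k)
  choose f hf using h1
  obtain ⟨m, hm⟩ : ∃ m : ℤ, ∀ k ∈ Finset.Ico 0 N, |f k| ≤ m :=
    ⟨∑ k ∈ Finset.Ico 0 N, |f k|, fun k hk =>
      Finset.single_le_sum (f := fun k => |f k|) (fun i _ => abs_nonneg _) hk⟩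
  have hw {u : ℤ → A} (hu : ∀ i, -m ≤ i → i ≤ m → u i = y i) (k : ℤ) :
      ∃ i, -m ≤ i ∧ i ≤ m ∧ u i ≠ w (i + k) := by
    have hk : k % N ∈ Finset.Ico 0 N :=
      Finset.mem_Ico.2 ⟨Int.emod_nonneg _ h.pos.ne', Int.emod_lt_of_pos _ h.pos⟩
    have hb := abs_le.1 (hm _ hk)
    refine ⟨f (k % N), hb.1, hb.2, ?_⟩
    rw [hu _ hb.1 hb.2]
    convert hf (k % N) using 1
    rw [← h.apply_add_mul (_ + k % N) (k / N), add_assoc, Int.emod_add_mul_ediv]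
  refine ⟨|a| + d + |m|, ?_⟩
  filter_upwards [eventually_window_eq y (-m) m] with u hu
  refine ⟨fun k e => ?_, fun j e => ?_⟩
  · obtain ⟨i, -, -, hi⟩ := hw hu k
    exact hi (by rw [e]; rfl)
  · have hd := h.nonneg
    have := neg_abs_le a
    have := le_abs_self a
    have := le_abs_self m
    constructor
    · by_contra! hj
      obtain ⟨i, hi1, hi2, hi⟩ := hw hu j
      apply hi
      rw [e]
      exact h.left _ (by linarith)
    · by_contra! hj
      obtain ⟨i, hi1, hi2, hi⟩ := hw hu (j + d)
      apply hi
      rw [e]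
      simp only [shiftZ]
      rw [h.right _ (by linarith)]
      congr 1
      ring

theorem mem_subshiftGen_iff (h : IsHomoclinic x w N a d) {y : ℤ → A} :
    y ∈ subshiftGen x ↔ (∃ k, y = shiftZ k x) ∨ ∃ k, y = shiftZ k w := by
  constructor
  · intro hy
    by_contra! hne
    obtain ⟨M, hM⟩ := h.exists_eventually_of_ne hne.2
    have h2 := eventually_ne_shiftZ (x := x) (-M) M fun j _ _ => hne.1 j
    obtain ⟨u, ⟨k, hk⟩, ⟨-, hu1⟩, hu2⟩ :=
      ((mem_closure_iff_frequently.1 hy).and_eventually (hM.and h2)).exists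
    exact hu2 k (hu1 k hk).1 (hu1 k hk).2 hk
  · rintro (⟨k, rfl⟩ | ⟨k, rfl⟩)
    · exact subset_closure ⟨k, rfl⟩
    · exact h.shiftZ_limit_mem k

theorem eventually_eq_shiftZ (h : IsHomoclinic x w N a d) (k : ℤ) :
    ∀ᶠ u in 𝓝 (shiftZ k x), u ∈ subshiftGen x → u = shiftZ k x := by
  obtain ⟨M, hM⟩ := h.exists_eventually_of_ne (h.shiftZ_ne k)
  have h2 : ∀ᶠ u in 𝓝 (shiftZ k x), ∀ j, -M ≤ j → j ≤ M → j ≠ k → u ≠ shiftZ j x := by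
    have := (Set.finite_Icc (-M) M).eventually_all (p := fun j u => j ≠ k → u ≠ shiftZ j x)
      (l := 𝓝 (shiftZ k x))
    filter_upwards [this.2 fun i _ => by
      by_cases hik : i = k
      · simp [hik]
      · filter_upwards [isOpen_ne.mem_nhds fun e => hik (h.shiftZ_self_injective e).symm]
          with u hu _ using hu] with u hu i h1 h2
    exact hu i ⟨h1, h2⟩
  filter_upwards [hM, h2] with u hu1 hu2 hu
  rcases h.mem_subshiftGen_iff.1 hu with ⟨j, hj⟩ | ⟨j, hj⟩
  · by_contra hne
    exact hu2 j (hu1.2 j hj).1 (hu1.2 j hj).2 (by rintro rfl; exact hne hj) hj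
  · exact absurd hj (hu1.1 j)

theorem eventually_near_limit (h : IsHomoclinic x w N a d) (k R : ℤ) :
    ∀ᶠ u in 𝓝 (shiftZ k w), u ∈ subshiftGen x → u = shiftZ k w ∨
      ∃ j, u = shiftZ j x ∧ ((j ≤ -R ∧ N ∣ j - k) ∨ (R ≤ j ∧ N ∣ j + d - k)) := by
  filter_upwards [eventually_window_eq (shiftZ k w) 0 N,
    eventually_ne_shiftZ (x := x) (-(|R| + |a| + d + N)) (|R| + |a| + d + N)
      fun j _ _ => (h.shiftZ_ne j k).symm] with u hu1 hu2 hu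
  have hd := h.nonneg
  have hN := h.pos
  have := neg_abs_le a
  have := le_abs_self a
  have := le_abs_self R
  have := abs_nonneg R
  have := abs_nonneg a
  rcases h.mem_subshiftGen_iff.1 hu with ⟨j, rfl⟩ | ⟨j, rfl⟩
  · right
    refine ⟨j, rfl, ?_⟩
    have hj : j < -(|R| + |a| + d + N) ∨ |R| + |a| + d + N < j := by
      by_contra! hj
      exact hu2 j hj.1 hj.2 rfl
    rcases hj with hj | hj
    · refine Or.inl ⟨by linarith, h.dvd_of_window fun i h0 h1 => ?_⟩
      rw [← h.left _ (by linarith)]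
      exact hu1 i h0 h1.le
    · refine Or.inr ⟨by linarith, h.dvd_of_window fun i h0 h1 => ?_⟩
      rw [← add_assoc, ← h.right _ (by linarith)]
      exact hu1 i h0 h1.le
  · left
    rw [h.shiftZ_eq_shiftZ_iff]
    exact h.dvd_of_window fun i h0 h1 => hu1 i h0 h1.le

end Topology

/-- The map from the suspension of the subshift generated by `x` to the spiral, on
representatives. -/
noncomputable def coord (x w : ℤ → A) (N a d : ℤ) (y : ℤ → A) (s : ℝ) :
    UnitAddCircle × OnePoint ℝ :=
  if h : ∃ k, y = shiftZ k x then spiral (winding a d (h.choose + s) / N)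
  else if h : ∃ k, y = shiftZ k w then limitCircle ((h.choose + s) / N)
  else limitCircle 0

theorem coord_shiftZ (h : IsHomoclinic x w N a d) (k : ℤ) (s : ℝ) :
    coord x w N a d (shiftZ k x) s = spiral (winding a d (k + s) / N) := by
  have hk : ∃ j, shiftZ k x = shiftZ j x := ⟨k, rfl⟩
  rw [coord, dif_pos hk, ← h.shiftZ_self_injective hk.choose_spec]

theorem coord_shiftZ_limit (h : IsHomoclinic x w N a d) (k : ℤ) (s : ℝ) :
    coord x w N a d (shiftZ k w) s = limitCircle ((k + s) / N) := by
  have hk : ∃ j, shiftZ k w = shiftZ j w := ⟨k, rfl⟩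
  have hN : (N : ℝ) ≠ 0 := by exact_mod_cast h.pos.ne'
  rw [coord, dif_neg fun ⟨j, hj⟩ => h.shiftZ_ne j k hj.symm, dif_pos hk, limitCircle_eq_iff]
  obtain ⟨m, hm⟩ := h.shiftZ_eq_shiftZ_iff.1 hk.choose_spec
  refine ⟨m, ?_⟩
  field_simp
  rw [sub_eq_iff_eq_add] at hm
  have : (k : ℝ) = N * m + hk.choose := by exact_mod_cast hm
  linarith

theorem coe_winding_eq (h : IsHomoclinic x w N a d) {j k R : ℤ} {s : ℝ}
    (hR : |(a : ℝ)| + d + |s| ≤ R)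
    (hj : (j ≤ -R ∧ N ∣ j - k) ∨ (R ≤ j ∧ N ∣ j + d - k)) :
    ((winding a d (j + s) / N : ℝ) : UnitAddCircle) = ((k + s) / N : ℝ) := by
  have hN : (N : ℝ) ≠ 0 := by exact_mod_cast h.pos.ne'
  have hd : (0 : ℝ) ≤ d := by exact_mod_cast h.nonneg
  have := neg_abs_le (a : ℝ)
  have := le_abs_self (a : ℝ)
  have := neg_abs_le s
  have := le_abs_self s
  refine congrArg Prod.fst (limitCircle_eq_iff.2 ?_)
  rcases hj with ⟨hj, m, hm⟩ | ⟨hj, m, hm⟩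
  · have hj' : (j : ℝ) ≤ -R := by exact_mod_cast hj
    have hm' : (j : ℝ) - k = N * m := by exact_mod_cast hm
    refine ⟨-m, ?_⟩
    rw [winding_of_le (by linarith)]
    field_simp
    push_cast
    linarith
  · have hj' : (R : ℝ) ≤ j := by exact_mod_cast hj
    have hm' : (j : ℝ) + d - k = N * m := by exact_mod_cast hm
    refine ⟨-m, ?_⟩
    rw [winding_of_ge h.nonneg (by linarith)]
    field_simp
    push_cast
    linarith

theorem le_abs_winding (hd : 0 ≤ d) {t R : ℝ} (hR : R + d ≤ |t|) : R ≤ |winding a d t| := by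
  have h1 := le_winding a d t
  have h2 := winding_le (a := a) hd t
  have hd' : (0 : ℝ) ≤ d := by exact_mod_cast hd
  rcases le_abs.1 hR with h | h
  · exact le_abs.2 (Or.inl (by linarith))
  · exact le_abs.2 (Or.inr (by linarith))

variable [TopologicalSpace A] [DiscreteTopology A]

theorem continuous_coord (h : IsHomoclinic x w N a d) :
    Continuous fun p : subshiftGen x × ℝ => coord x w N a d p.1 p.2 := by
  have hN : (0 : ℝ) < N := by exact_mod_cast h.pos
  rw [continuous_iff_continuousAt]
  rintro ⟨⟨y, hy⟩, s⟩
  have hproj : Tendsto (fun p : subshiftGen x × ℝ => (p.1 : ℤ → A)) (𝓝 (⟨y, hy⟩, s)) (𝓝 y) :=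
    (continuous_subtype_val.comp continuous_fst).tendsto _
  rcases h.mem_subshiftGen_iff.1 hy with ⟨k, rfl⟩ | ⟨k, rfl⟩
  · have hc : Continuous fun p : subshiftGen x × ℝ => spiral (winding a d (k + p.2) / N) := by
      have := winding_continuous a d
      exact continuous_spiral.comp (by fun_prop)
    refine hc.continuousAt.congr ?_
    filter_upwards [hproj.eventually (h.eventually_eq_shiftZ k)] with p hp
    rw [hp p.1.2, h.coord_shiftZ]
  · have hs : ∀ᶠ p : subshiftGen x × ℝ in 𝓝 (⟨shiftZ k w, hy⟩, s), |p.2| < |s| + 1 :=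
      (continuous_abs.comp continuous_snd).continuousAt.eventually (gt_mem_nhds (lt_add_one _))
    have near (R : ℤ) := hproj.eventually (h.eventually_near_limit k R)
    suffices ContinuousAt (fun p : subshiftGen x × ℝ => (coord x w N a d p.1 p.2).1)
        (⟨shiftZ k w, hy⟩, s) ∧ ContinuousAt
        (fun p : subshiftGen x × ℝ => (coord x w N a d p.1 p.2).2) (⟨shiftZ k w, hy⟩, s) from
      this.1.prodMk this.2
    constructor
    · have hc : Continuous fun p : subshiftGen x × ℝ => (((k + p.2) / N : ℝ) : UnitAddCircle) :=
        (AddCircle.continuous_mk' 1).comp (by fun_prop)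
      refine hc.continuousAt.congr ?_
      obtain ⟨R, hR⟩ := exists_int_gt (|(a : ℝ)| + d + (|s| + 1))
      filter_upwards [hs, near R] with p hp1 hp2
      rcases hp2 p.1.2 with e | ⟨j, e, hj⟩
      · rw [e, h.coord_shiftZ_limit]
        rfl
      · rw [e, h.coord_shiftZ]
        exact (h.coe_winding_eq (by linarith) hj).symm
    · rw [ContinuousAt, h.coord_shiftZ_limit]
      intro S hS
      change S ∈ 𝓝 OnePoint.infty at hS
      rw [OnePoint.nhds_infty_eq, coclosedCompact_eq_cocompact, ← Metric.cobounded_eq_cocompact]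
        at hS
      obtain ⟨hS1, hS2⟩ := hS
      obtain ⟨r, -, hr⟩ := (hasBasis_cobounded_norm (E := ℝ)).mem_iff.1 (mem_map.1 hS1)
      obtain ⟨R, hR⟩ := exists_int_gt (|r * N| + d + (|s| + 1))
      rw [mem_map]
      filter_upwards [hs, near R] with p hp1 hp2
      change (coord x w N a d p.1 p.2).2 ∈ S
      rcases hp2 p.1.2 with e | ⟨j, e, hj⟩
      · rw [e, h.coord_shiftZ_limit]
        exact hS2
      · rw [e, h.coord_shiftZ]
        apply hr
        change r ≤ ‖_‖
        rw [Real.norm_eq_abs, abs_div, abs_of_pos hN, le_div_iff₀ hN]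
        apply le_abs_winding h.nonneg
        have hj' : (R : ℝ) ≤ |(j : ℝ)| := by
          rcases hj with ⟨hj, -⟩ | ⟨hj, -⟩
          · exact le_abs.2 (Or.inr (by rw [le_neg]; exact_mod_cast hj))
          · exact le_abs.2 (Or.inl (by exact_mod_cast hj))
        have := le_abs_self (r * N)
        have := abs_sub_abs_le_abs_add (j : ℝ) p.2
        linarith

/-- The map from the suspension of the subshift generated by `x` to the spiral. -/
noncomputable def toSpiral (h : IsHomoclinic x w N a d) :
    Susp (subshiftGen x) → UnitAddCircle × OnePoint ℝ :=
  Quot.lift (fun p => coord x w N a d p.1 p.2) (by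
    rintro ⟨⟨y, hy⟩, s⟩ ⟨⟨z, hz⟩, t⟩ ⟨n, h1, h2⟩
    simp only at h1 h2 ⊢
    subst h1 h2
    rcases h.mem_subshiftGen_iff.1 hy with ⟨k, rfl⟩ | ⟨k, rfl⟩
    · rw [shiftZ_shiftZ, h.coord_shiftZ, h.coord_shiftZ]
      push_cast
      ring_nf
    · rw [shiftZ_shiftZ, h.coord_shiftZ_limit, h.coord_shiftZ_limit]
      push_cast
      ring_nf)

theorem continuous_toSpiral (h : IsHomoclinic x w N a d) : Continuous h.toSpiral :=
  continuous_quot_lift _ h.continuous_coord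

theorem exists_eq_mk (h : IsHomoclinic x w N a d) (u : Susp (subshiftGen x)) :
    (∃ (hy : shiftZ 0 x ∈ subshiftGen x) (s : ℝ), u = Quot.mk _ (⟨shiftZ 0 x, hy⟩, s)) ∨
    ∃ (hy : shiftZ 0 w ∈ subshiftGen x) (s : ℝ), u = Quot.mk _ (⟨shiftZ 0 w, hy⟩, s) := by
  have hx : shiftZ 0 x ∈ subshiftGen x := h.mem_subshiftGen_iff.2 (Or.inl ⟨0, rfl⟩)
  have hw : shiftZ 0 w ∈ subshiftGen x := h.mem_subshiftGen_iff.2 (Or.inr ⟨0, rfl⟩)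
  obtain ⟨⟨⟨y, hy⟩, s⟩, rfl⟩ := Quot.exists_rep u
  rcases h.mem_subshiftGen_iff.1 hy with ⟨k, rfl⟩ | ⟨k, rfl⟩
  · exact Or.inl ⟨hx, s + k, Quot.sound ⟨-k, by simp [shiftZ_shiftZ], by simp⟩⟩
  · exact Or.inr ⟨hw, s + k, Quot.sound ⟨-k, by simp [shiftZ_shiftZ], by simp⟩⟩

theorem toSpiral_mk (h : IsHomoclinic x w N a d) (hy : shiftZ 0 x ∈ subshiftGen x) (s : ℝ) :
    h.toSpiral (Quot.mk _ (⟨shiftZ 0 x, hy⟩, s)) = spiral (winding a d s / N) :=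
  (h.coord_shiftZ 0 s).trans (by simp)

theorem toSpiral_mk_limit (h : IsHomoclinic x w N a d) (hy : shiftZ 0 w ∈ subshiftGen x)
    (s : ℝ) : h.toSpiral (Quot.mk _ (⟨shiftZ 0 w, hy⟩, s)) = limitCircle (s / N) :=
  (h.coord_shiftZ_limit 0 s).trans (by simp)

theorem toSpiral_injective (h : IsHomoclinic x w N a d) : Function.Injective h.toSpiral := by
  have hN : (N : ℝ) ≠ 0 := by exact_mod_cast h.pos.ne'
  intro u v e
  rcases h.exists_eq_mk u with ⟨hu, s, rfl⟩ | ⟨hu, s, rfl⟩ <;>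
  rcases h.exists_eq_mk v with ⟨hv, t, rfl⟩ | ⟨hv, t, rfl⟩ <;>
  simp only [toSpiral_mk, toSpiral_mk_limit] at e
  · rw [(winding_strictMono a d).injective ((div_left_inj' hN).1 (spiral_injective e))]
  · exact absurd e (spiral_ne_limitCircle _ _)
  · exact absurd e.symm (spiral_ne_limitCircle _ _)
  · obtain ⟨m, hm⟩ := limitCircle_eq_iff.1 e
    refine Quot.sound ⟨-(N * m), ?_, ?_⟩
    · simp only [shiftZ_shiftZ]
      rw [h.shiftZ_eq_shiftZ_iff]
      simp
    · field_simp at hm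
      push_cast
      linarith

theorem range_toSpiral (h : IsHomoclinic x w N a d) :
    Set.range h.toSpiral = Set.range spiral ∪ Set.range limitCircle := by
  have hN : (N : ℝ) ≠ 0 := by exact_mod_cast h.pos.ne'
  have hx : shiftZ 0 x ∈ subshiftGen x := h.mem_subshiftGen_iff.2 (Or.inl ⟨0, rfl⟩)
  have hw : shiftZ 0 w ∈ subshiftGen x := h.mem_subshiftGen_iff.2 (Or.inr ⟨0, rfl⟩)
  apply subset_antisymm
  · rintro _ ⟨u, rfl⟩
    rcases h.exists_eq_mk u with ⟨hu, s, rfl⟩ | ⟨hu, s, rfl⟩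
    · exact Or.inl ⟨_, (h.toSpiral_mk hu s).symm⟩
    · exact Or.inr ⟨_, (h.toSpiral_mk_limit hu s).symm⟩
  · rintro _ (⟨r, rfl⟩ | ⟨r, rfl⟩)
    · obtain ⟨s, hs⟩ := winding_surjective (a := a) h.nonneg (r * N)
      exact ⟨Quot.mk _ (⟨_, hx⟩, s), by
        rw [h.toSpiral_mk hx s, hs, mul_div_cancel_right₀ _ hN]⟩
    · exact ⟨Quot.mk _ (⟨_, hw⟩, r * N), by
        rw [h.toSpiral_mk_limit hw (r * N), mul_div_cancel_right₀ _ hN]⟩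

theorem exists_orderIso_toSpiral_suspFlow (h : IsHomoclinic x w N a d)
    (u : Susp (subshiftGen x)) :
    ∃ τ : ℝ ≃o ℝ, τ 0 = 0 ∧
      ∀ t, h.toSpiral (suspFlow _ t u) = spiralFlow (τ t) (h.toSpiral u) := by
  have hN : (0 : ℝ) < N := by exact_mod_cast h.pos
  rcases h.exists_eq_mk u with ⟨hu, s, rfl⟩ | ⟨hu, s, rfl⟩
  · have hmono : StrictMono fun t => (winding a d (s + t) - winding a d s) / N := by
      intro t t' htt
      have := winding_strictMono a d (add_lt_add_right htt s)
      exact div_lt_div_of_pos_right (by linarith) hN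
    have hsurj : Function.Surjective fun t => (winding a d (s + t) - winding a d s) / N := by
      intro r
      obtain ⟨t, ht⟩ := winding_surjective (a := a) h.nonneg (r * N + winding a d s)
      exact ⟨t - s, by simp [ht, hN.ne']⟩
    refine ⟨hmono.orderIsoOfSurjective _ hsurj, by simp, fun t => ?_⟩
    rw [h.toSpiral_mk, spiralFlow_spiral]
    refine (h.toSpiral_mk hu (s + t)).trans ?_
    simp only [StrictMono.coe_orderIsoOfSurjective]
    congr 1
    ring
  · have hmono : StrictMono fun t : ℝ => t / N := fun t t' htt => div_lt_div_of_pos_right htt hN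
    have hsurj : Function.Surjective fun t : ℝ => t / N := fun r => ⟨r * N, by simp [hN.ne']⟩
    refine ⟨hmono.orderIsoOfSurjective _ hsurj, by simp, fun t => ?_⟩
    rw [h.toSpiral_mk_limit, spiralFlow_limitCircle]
    refine (h.toSpiral_mk_limit hu (s + t)).trans ?_
    simp only [StrictMono.coe_orderIsoOfSurjective]
    congr 1
    ring

theorem compactSpace_susp [Finite A] (h : IsHomoclinic x w N a d) :
    CompactSpace (Susp (subshiftGen x)) := by
  have : CompactSpace (subshiftGen x) := isCompact_iff_compactSpace.1 isClosed_closure.isCompact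
  have hK : IsCompact (Set.univ ×ˢ Set.Icc 0 1 : Set (subshiftGen x × ℝ)) :=
    isCompact_univ.prod isCompact_Icc
  have himage := hK.image (f := Quot.mk (SuspRel (subshiftGen x))) continuous_quot_mk
  refine ⟨himage.of_isClosed_subset isClosed_univ fun u _ => ?_⟩
  obtain ⟨⟨⟨y, hy⟩, s⟩, rfl⟩ := Quot.exists_rep u
  have hy' : shiftZ ⌊s⌋ y ∈ subshiftGen x := by
    rcases h.mem_subshiftGen_iff.1 hy with ⟨k, rfl⟩ | ⟨k, rfl⟩ <;> rw [shiftZ_shiftZ]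
    · exact h.mem_subshiftGen_iff.2 (Or.inl ⟨_, rfl⟩)
    · exact h.mem_subshiftGen_iff.2 (Or.inr ⟨_, rfl⟩)
  refine ⟨(⟨shiftZ ⌊s⌋ y, hy'⟩, Int.fract s),
    ⟨trivial, Int.fract_nonneg s, (Int.fract_lt_one s).le⟩, ?_⟩
  exact (Quot.sound ⟨⌊s⌋, rfl, rfl⟩).symm

theorem isEmbedding_toSpiral [Finite A] (h : IsHomoclinic x w N a d) :
    IsEmbedding h.toSpiral :=
  have := h.compactSpace_susp
  (h.continuous_toSpiral.isClosedEmbedding h.toSpiral_injective).isEmbedding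

theorem flowEquiv [Finite A] {B : Type*} [TopologicalSpace B] [DiscreteTopology B] [Finite B]
    {x' w' : ℤ → B} {N' a' d' : ℤ} (h : IsHomoclinic x w N a d)
    (h' : IsHomoclinic x' w' N' a' d') : FlowEquiv (subshiftGen x) (subshiftGen x') := by
  let e : Susp (subshiftGen x) ≃ₜ Susp (subshiftGen x') :=
    (h.isEmbedding_toSpiral.toHomeomorph.trans
      (Homeomorph.setCongr (h.range_toSpiral.trans h'.range_toSpiral.symm))).trans
      h'.isEmbedding_toSpiral.toHomeomorph.symm
  have he (u) : h'.toSpiral (e u) = h.toSpiral u :=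
    congrArg Subtype.val (h'.isEmbedding_toSpiral.toHomeomorph.apply_symm_apply _)
  refine ⟨e, fun u => ?_⟩
  obtain ⟨τ, hτ0, hτ⟩ := h.exists_orderIso_toSpiral_suspFlow u
  obtain ⟨τ', hτ0', hτ'⟩ := h'.exists_orderIso_toSpiral_suspFlow (e u)
  refine ⟨τ.trans τ'.symm, OrderIso.strictMono _, OrderIso.bijective _, ?_, fun t => ?_⟩
  · rw [OrderIso.trans_apply, hτ0, OrderIso.symm_apply_eq, hτ0']
  · apply h'.toSpiral_injective
    rw [he, hτ, hτ', he]
    simp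

end IsHomoclinic

theorem exists_isHomoclinic {A : Type*} {x w : ℤ → A} {N b c d : ℤ} (hN : 0 < N)
    (hw : shiftZ N w = w) (left : ∀ i ≤ b, x i = w i) (right : ∀ i, c ≤ i → x i = w (i + d))
    (ne : x ≠ w) : ∃ N' a' d', IsHomoclinic x w N' a' d' := by
  let H : AddSubgroup ℤ :=
    { carrier := {k | shiftZ k w = w}
      add_mem' := fun {j k} hj hk => by
        simp only [Set.mem_ofPred_eq] at *
        rw [← shiftZ_shiftZ, hj, hk]
      zero_mem' := shiftZ_zero w
      neg_mem' := fun {k} hk => by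
        simp only [Set.mem_ofPred_eq] at *
        apply shiftZ_injective k
        rw [shiftZ_shiftZ, neg_add_cancel, shiftZ_zero, hk] }
  have hmem (k : ℤ) : shiftZ k w = w ↔ k ∈ H := Iff.rfl
  obtain ⟨g, hg⟩ := Int.subgroup_cyclic H
  have hmem' (k : ℤ) : shiftZ k w = w ↔ g ∣ k := by
    rw [hmem, hg, ← AddSubgroup.zmultiples_eq_closure, Int.mem_zmultiples_iff]
  have hg0 : g ≠ 0 := by
    rintro rfl
    exact hN.ne' (zero_dvd_iff.1 ((hmem' N).1 hw))
  have hNm (m : ℤ) : shiftZ (N * m) w = w := (hmem' _).2 (((hmem' N).1 hw).mul_right m)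
  have hn : |d| + |c - b| ≤ N * (|d| + |c - b|) := by
    nlinarith [abs_nonneg d, abs_nonneg (c - b)]
  have := neg_abs_le d
  have := le_abs_self (c - b)
  refine ⟨|g|, b, d + N * (|d| + |c - b|), abs_pos.2 hg0, fun k => ?_, ?_, left, fun i hi => ?_, ne⟩
  · rw [abs_dvd, hmem']
  · linarith [abs_nonneg (c - b)]
  · rw [right i (by linarith), ← add_assoc]
    exact (congrFun (hNm _) (i + d)).symm

theorem cellStart_eq {z : ℤ → ℕ} {F : ℤ → ℤ} (h : ∀ n, (z n : ℤ) = F (n + 1) - F n) (n : ℤ) :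
    cellStart z n = n + F n - F 0 := by
  have pos (n : ℕ) : ∑ j ∈ Finset.Ico (0 : ℤ) n, (z j : ℤ) = F n - F 0 := by
    induction n with
    | zero => simp
    | succ n ih =>
      rw [Nat.cast_succ, ← Finset.insert_Ico_right_eq_Ico_add_one (by positivity),
        Finset.sum_insert (by simp), ih, h]
      ring
  have neg (n : ℕ) : ∑ j ∈ Finset.Ico (-n : ℤ) 0, (z j : ℤ) = F 0 - F (-n) := by
    induction n with
    | zero => simp
    | succ n ih =>
      have e : Finset.Ico (-(n + 1 : ℕ) : ℤ) 0 =
          insert (-(n + 1 : ℕ) : ℤ) (Finset.Ico (-n : ℤ) 0) := by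
        ext i
        simp only [Finset.mem_Ico, Finset.mem_insert]
        lia
      rw [e, Finset.sum_insert (by simp), ih, h]
      push_cast
      ring_nf
  unfold cellStart
  split_ifs with hn
  · lift n to ℕ using hn
    rw [pos]
    ring
  · obtain ⟨m, rfl⟩ : ∃ m : ℕ, n = -m := ⟨n.natAbs, by lia⟩
    rw [neg]
    ring

theorem eq_of_strictMono_of_range_eq {c f : ℤ → ℤ} (hc : StrictMono c) (hf : StrictMono f)
    (h0 : c 0 = f 0) (h : Set.range c = Set.range f) {n : ℤ} (hn : 0 ≤ n) : c n = f n := by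
  have hr {c f : ℤ → ℤ} (hc : StrictMono c) (hf : StrictMono f) (h0 : c 0 = f 0)
      (h : Set.range c = Set.range f) :
      (Set.range fun n : ℕ => c n) ⊆ Set.range fun n : ℕ => f n := by
    rintro _ ⟨n, rfl⟩
    obtain ⟨m, hm⟩ : c n ∈ Set.range f := h ▸ ⟨_, rfl⟩
    have : 0 ≤ m := by
      rw [← hf.le_iff_le, hm, ← h0, hc.le_iff_le]
      positivity
    lift m to ℕ using this
    exact ⟨m, hm⟩
  have hc' : StrictMono fun n : ℕ => c n := hc.comp Nat.strictMono_cast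
  have hf' : StrictMono fun n : ℕ => f n := hf.comp Nat.strictMono_cast
  have := (hc'.range_inj hf').1 ((hr hc hf h0 h).antisymm (hr hf hc h0.symm h.symm))
  lift n to ℕ using hn
  exact congrFun this n

/-- A criterion for the sequence of cells of lengths `z` to be homoclinic to a periodic one,
in terms of the positions `f n` of the letter `1` in the periodic sequence. -/
theorem exists_isHomoclinic_seqOfCells {z : ℤ → ℕ} {f : ℤ → ℤ} {p N m d : ℤ} (hN : 0 < N)
    (hp : 0 < p) (hf : StrictMono f) (hper : ∀ n, f (n + p) = f n + N)
    (hz : StrictMono (cellStart z)) (left : ∀ n ≤ 0, cellStart z n = f n)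
    (right : ∀ n, 1 ≤ n → cellStart z n + d = f (n + m)) (ne : cellStart z p ≠ f p) :
    ∃ w N' a' d', IsHomoclinic (seqOfCells z) w N' a' d' := by
  refine ⟨fun i => if ∃ n, i = f n then 1 else 0,
    exists_isHomoclinic (b := 0) (c := cellStart z 1) (d := d) hN ?_ ?_ ?_ ?_⟩
  · funext i
    simp only [shiftZ]
    congr 1
    refine propext ⟨?_, ?_⟩
    · rintro ⟨n, hn⟩
      refine ⟨n - p, ?_⟩
      have := hper (n - p)
      rw [sub_add_cancel] at this
      linarith
    · rintro ⟨n, hn⟩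
      exact ⟨n + p, by rw [hper, hn]⟩
  · intro i hi
    have h0 : cellStart z 0 = 0 := by simp [cellStart]
    have h0' : f 0 = 0 := by rw [← left 0 le_rfl, h0]
    simp only [seqOfCells]
    congr 1
    refine propext ⟨?_, ?_⟩
    · rintro ⟨n, rfl⟩
      exact ⟨n, left n (by rwa [← hz.le_iff_le, h0])⟩
    · rintro ⟨n, rfl⟩
      exact ⟨n, (left n (by rwa [← hf.le_iff_le, h0'])).symm⟩
  · intro i hi
    simp only [seqOfCells]
    congr 1
    refine propext ⟨?_, ?_⟩
    · rintro ⟨n, rfl⟩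
      exact ⟨n + m, right n (hz.le_iff_le.1 hi)⟩
    · rintro ⟨n, hn⟩
      have h1 : 1 ≤ n - m := by
        have := right 1 le_rfl
        have : f (1 + m) ≤ f n := by linarith
        linarith [hf.le_iff_le.1 this]
      have := right _ h1
      rw [sub_add_cancel] at this
      exact ⟨n - m, by linarith⟩
  · intro e
    apply ne
    refine eq_of_strictMono_of_range_eq hz hf (left 0 le_rfl) ?_ hp.le
    ext i
    have := congrFun e i
    simp only [seqOfCells] at this
    constructor
    · rintro ⟨n, hn⟩
      by_contra hi
      rw [if_pos ⟨n, hn.symm⟩, if_neg fun ⟨k, hk⟩ => hi ⟨k, hk.symm⟩] at this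
      exact absurd this (by decide)
    · rintro ⟨n, hn⟩
      by_contra hi
      rw [if_neg fun ⟨k, hk⟩ => hi ⟨k, hk.symm⟩, if_pos ⟨n, hn.symm⟩] at this
      exact absurd this (by decide)

theorem ncard_multiples {p : ℤ} (hp : 0 < p) {S : Set ℤ} {A B : ℤ} (hAB : A ≤ B)
    (hS : ∀ k, k ∈ S ↔ A < k * p ∧ k * p ≤ B) : (S.ncard : ℤ) = B / p - A / p := by
  have : S = Finset.Ioc (A / p) (B / p) := by
    ext k
    simp [hS, Int.ediv_lt_iff_lt_mul hp, Int.le_ediv_iff_mul_le hp]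
  rw [this, Set.ncard_coe_finset, Int.card_Ioc,
    Int.toNat_of_nonneg (sub_nonneg.2 (Int.ediv_le_ediv hp hAB))]

section Cells

variable {p q : ℤ}

theorem lt_mul_div_iff (hq : 0 < q) (k m : ℤ) :
    (m : ℚ) < (k : ℚ) * ((p : ℚ) / q) ↔ m * q < k * p := by
  rw [← mul_div_assoc, lt_div_iff₀ (by exact_mod_cast hq)]
  exact_mod_cast Iff.rfl

theorem mul_div_lt_iff (hq : 0 < q) (k m : ℤ) :
    (k : ℚ) * ((p : ℚ) / q) < m ↔ k * p < m * q := by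
  rw [← mul_div_assoc, div_lt_iff₀ (by exact_mod_cast hq)]
  exact_mod_cast Iff.rfl

theorem cellLenS_eq (hp : 0 < p) (hq : 0 < q) (n : ℤ) :
    (cellLenS p q n : ℤ) =
      (if n + 1 ≤ 0 then (n + 1) * q / p else ((n + 1) * q - 1) / p) -
        (if n ≤ 0 then n * q / p else (n * q - 1) / p) := by
  have lt := lt_mul_div_iff (p := p) hq
  have lt' := mul_div_lt_iff (p := p) hq
  have cast : (n : ℚ) + 1 = (n + 1 : ℤ) := by push_cast; rfl
  unfold cellLenS
  split_ifs <;> first | lia | skip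
  · apply ncard_multiples hp (by nlinarith)
    intro k
    rw [Set.mem_ofPred_eq, cast, lt, ← not_lt, lt, not_lt]
  · subst n
    have e : (0 + 1) * q - 1 = q - 1 := by ring
    rw [e]
    apply ncard_multiples hp (by nlinarith)
    intro k
    have h0 := lt k 0
    have h1 := lt' k 1
    push_cast at h0 h1
    rw [Set.mem_ofPred_eq, h0, h1]
    lia
  · apply ncard_multiples hp (by nlinarith)
    intro k
    rw [Set.mem_ofPred_eq, cast, lt', ← not_lt, lt']
    lia

theorem cellLenS'_eq (hp : 0 < p) (hq : 0 < q) (n : ℤ) :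
    (cellLenS' p q n : ℤ) =
      (if n + 1 ≤ 0 then ((n + 1) * q - 1) / p else (n + 1) * q / p) -
        (if n ≤ 0 then (n * q - 1) / p else n * q / p) := by
  have lt := lt_mul_div_iff (p := p) hq
  have lt' := mul_div_lt_iff (p := p) hq
  have cast : (n : ℚ) + 1 = (n + 1 : ℤ) := by push_cast; rfl
  unfold cellLenS'
  split_ifs <;> first | lia | skip
  · apply ncard_multiples hp (by nlinarith)
    intro k
    rw [Set.mem_ofPred_eq, cast, lt', ← not_lt, lt']
    lia
  · subst n
    have e : (0 + 1) * q = q := by ring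
    rw [e]
    apply ncard_multiples hp (by nlinarith)
    intro k
    have h0 := lt' k 0
    have h1 := lt k 1
    push_cast at h0 h1
    rw [Set.mem_ofPred_eq, ← not_lt, h0, ← not_lt, h1]
    lia
  · apply ncard_multiples hp (by nlinarith)
    intro k
    rw [Set.mem_ofPred_eq, cast, lt, ← not_lt, lt, not_lt]

theorem cellStart_strictMono (z : ℤ → ℕ) {F : ℤ → ℤ} (h : ∀ n, (z n : ℤ) = F (n + 1) - F n) :
    StrictMono (cellStart z) := by
  apply strictMono_int_of_lt_succ
  intro n
  rw [cellStart_eq h, cellStart_eq h]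
  have := h n
  lia

theorem strictMono_add_ediv (hp : 0 < p) (hq : 0 < q) (e : ℤ) :
    StrictMono fun n => n + (n * q + e) / p :=
  strictMono_id.add_monotone fun _ _ h => Int.ediv_le_ediv hp (by nlinarith)

theorem exists_isHomoclinic_sturmS (hp : 0 < p) (hq : 0 < q) (hpq : IsCoprime p q) :
    ∃ w N a d, IsHomoclinic (sturmS p q) w N a d := by
  let F : ℤ → ℤ := fun n => if n ≤ 0 then n * q / p else (n * q - 1) / p
  have hz (n) : (_ : ℤ) = F (n + 1) - F n := cellLenS_eq hp hq n
  have hF := cellStart_eq hz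
  obtain ⟨u, v, huv⟩ := hpq
  refine exists_isHomoclinic_seqOfCells (f := fun n => n + n * q / p) (p := p) (N := p + q)
    (m := -v) (d := -v + u) (by lia) hp (by simpa using strictMono_add_ediv hp hq 0)
    (fun n => ?_) (cellStart_strictMono _ hz) (fun n hn => ?_) (fun n hn => ?_) ?_
  · rw [add_mul, mul_comm p q, Int.add_mul_ediv_right _ _ hp.ne']
    ring
  · simp [hF, F, hn]
  · have e : (n + -v) * q = (n * q - 1) + u * p := by linear_combination -huv
    simp only [hF, F, show ¬ n ≤ 0 by lia, if_false]
    rw [e, Int.add_mul_ediv_right _ _ hp.ne']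
    simp
    ring
  · have e : p * q - 1 = -1 + q * p := by ring
    simp only [hF, F, show ¬ p ≤ 0 by lia, if_false]
    rw [e, Int.add_mul_ediv_right _ _ hp.ne', Int.mul_ediv_cancel_left _ hp.ne',
      Int.ediv_eq_neg_one_of_neg_of_le (by simp) (by simp; lia)]
    simp

theorem exists_isHomoclinic_sturmS' (hp : 0 < p) (hq : 0 < q) (hpq : IsCoprime p q) :
    ∃ w N a d, IsHomoclinic (sturmS' p q) w N a d := by
  let F : ℤ → ℤ := fun n => if n ≤ 0 then (n * q - 1) / p else n * q / p
  have hz (n) : (_ : ℤ) = F (n + 1) - F n := cellLenS'_eq hp hq n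
  have hF := cellStart_eq hz
  have hone : (-1) / p = -1 := Int.ediv_eq_neg_one_of_neg_of_le (by simp) (by simp; lia)
  obtain ⟨u, v, huv⟩ := hpq
  refine exists_isHomoclinic_seqOfCells (f := fun n => n + (n * q - 1) / p + 1) (p := p)
    (N := p + q) (m := v) (d := v - u) (by lia) hp
    ((strictMono_add_ediv hp hq (-1)).add_const 1)
    (fun n => ?_) (cellStart_strictMono _ hz) (fun n hn => ?_) (fun n hn => ?_) ?_
  · have e : (n + p) * q - 1 = n * q - 1 + q * p := by ring
    rw [e, Int.add_mul_ediv_right _ _ hp.ne']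
    ring
  · simp [hF, F, hn, hone]
  · have e : (n + v) * q - 1 = n * q + (-u) * p := by linear_combination huv
    simp only [hF, F, show ¬ n ≤ 0 by lia, if_false]
    rw [e, Int.add_mul_ediv_right _ _ hp.ne']
    simp [hone]
    ring
  · have e : p * q - 1 = -1 + q * p := by ring
    simp only [hF, F, show ¬ p ≤ 0 by lia, if_false]
    rw [e, Int.add_mul_ediv_right _ _ hp.ne', Int.mul_ediv_cancel_left _ hp.ne', hone]
    simp [hone]

end Cells

/-- Any two skew Sturmian subshifts (of either type and any frequencies)
are flow equivalent. -/
theorem stmt_19 (p q p' q' : ℤ) (hp : 0 < p) (hq : 0 < q) (hpq : IsCoprime p q)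
    (hp' : 0 < p') (hq' : 0 < q') (hpq' : IsCoprime p' q')
    (x y : ℤ → Fin 2)
    (hx : x = sturmS p q ∨ x = sturmS' p q)
    (hy : y = sturmS p' q' ∨ y = sturmS' p' q') :
    FlowEquiv (subshiftGen x) (subshiftGen y) := by
  have homoclinic {p q : ℤ} {x : ℤ → Fin 2} (hp : 0 < p) (hq : 0 < q) (hpq : IsCoprime p q)
      (hx : x = sturmS p q ∨ x = sturmS' p q) : ∃ w N a d, IsHomoclinic x w N a d := by
    rcases hx with rfl | rfl
    · exact exists_isHomoclinic_sturmS hp hq hpq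
    · exact exists_isHomoclinic_sturmS' hp hq hpq
  obtain ⟨_, _, _, _, h⟩ := homoclinic hp hq hpq hx
  obtain ⟨_, _, _, _, h'⟩ := homoclinic hp' hq' hpq' hy
  exact h.flowEquiv h'
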